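/- Let α be a type with decidable equality, let S be a finite subset of α, let A₀ ⊆ S, and let k be a natural number with |A₀| ≤ k < |S|. Consider the probability mass function obtained by first choosing B uniformly at random among the subsets of S of cardinality k that contain A₀, and then choosing an element j uniformly at random from S \ B. Then the resulting distribution of j is exactly the uniform distribution on S \ A₀. Formally, with p₁ the uniform PMF on the finset {B ∈ powersetCard k S | A₀ ⊆ B} and, for each such B, p₂(B) the uniform PMF on S \ B, the PMF p₁.bind p₂ equals the uniform PMF on S \ A₀. -/

import Mathlib

open Finset in
theorem aux_le {α : Type*} [DecidableEq α] (S A : Finset α) (k : ℕ) (i j : α)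
    (hi : i ∈ S \ A) (hj : j ∈ S \ A) :
    (((powersetCard k S).filter (fun B => A ⊆ B)).filter (fun B => i ∉ B)).card ≤
    (((powersetCard k S).filter (fun B => A ⊆ B)).filter (fun B => j ∉ B)).card := by
  rw [mem_sdiff] at hi hj
  apply card_le_card_of_injOn (fun B => B.image (Equiv.swap i j))
  · intro B hB
    simp only [coe_filter, mem_filter, mem_powersetCard, Set.mem_ofPred_eq] at hB ⊢
    obtain ⟨⟨⟨hBS, hc⟩, hAB⟩, hiB⟩ := hB
    refine ⟨⟨⟨?_, ?_⟩, ?_⟩, ?_⟩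
    · intro x hx
      obtain ⟨y, hy, rfl⟩ := mem_image.1 hx
      rw [Equiv.swap_apply_def]
      split_ifs
      · exact hj.1
      · exact hi.1
      · exact hBS hy
    · rw [card_image_of_injective _ (Equiv.injective _), hc]
    · intro x hx
      refine mem_image.2 ⟨x, hAB hx, Equiv.swap_apply_of_ne_of_ne ?_ ?_⟩
      · rintro rfl; exact hi.2 hx
      · rintro rfl; exact hj.2 hx
    · intro h
      obtain ⟨y, hy, h⟩ := mem_image.1 h
      have : y = i := (Equiv.swap i j).injective (by rw [h, Equiv.swap_apply_left])
      exact hiB (this ▸ hy)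
  · exact (image_injective (Equiv.injective _)).injOn

open Finset in
theorem aux_count {α : Type*} [DecidableEq α] (S A : Finset α) (k : ℕ) (j : α)
    (hj : j ∈ S \ A) :
    (S \ A).card * (((powersetCard k S).filter (fun B => A ⊆ B)).filter (fun B => j ∉ B)).card =
    ((powersetCard k S).filter (fun B => A ⊆ B)).card * (S.card - k) := by
  have h := sum_card_bipartiteAbove_eq_sum_card_bipartiteBelow (s := S \ A)
    (t := (powersetCard k S).filter (fun B => A ⊆ B)) (fun i B => i ∉ B)
  unfold bipartiteAbove bipartiteBelow at h
  rw [sum_const_nat (fun i hi => le_antisymm (aux_le S A k i j hi hj) (aux_le S A k j i hj hi))] at h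
  rw [h]
  apply sum_const_nat
  intro B hB
  simp only [mem_filter, mem_powersetCard] at hB
  obtain ⟨⟨hBS, hc⟩, hAB⟩ := hB
  rw [← hc, ← card_sdiff_of_subset hBS]
  congr 1
  ext x
  simp only [mem_filter, mem_sdiff]
  exact ⟨fun h => ⟨h.1.1, h.2⟩, fun h => ⟨⟨h.1, fun hx => h.2 (hAB hx)⟩, h.2⟩⟩

/-- Choosing a set `B` uniformly among the size-`k` subsets of `S` containing `A₀`,
and then choosing `j` uniformly from `S \ B`, yields the uniform distribution on
`S \ A₀`. -/
theorem bind_uniform_supersets_uniform_sdiff {α : Type*} [DecidableEq α]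
    (S A₀ : Finset α) (hA : A₀ ⊆ S) (k : ℕ) (hk₁ : A₀.card ≤ k) (hk₂ : k < S.card)
    (p₂ : Finset α → PMF α)
    (hp₂ : ∀ B ∈ (Finset.powersetCard k S).filter (fun B => A₀ ⊆ B),
      ∀ h : (S \ B).Nonempty, p₂ B = PMF.uniformOfFinset (S \ B) h) :
    (PMF.uniformOfFinset ((Finset.powersetCard k S).filter (fun B => A₀ ⊆ B))
        (by
          obtain ⟨B, hAB, hBS, hBcard⟩ :=
            Finset.exists_subsuperset_card_eq hA hk₁ (le_of_lt hk₂)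
          exact ⟨B, by simp [Finset.mem_powersetCard, hBS, hBcard, hAB]⟩)).bind p₂ =
      PMF.uniformOfFinset (S \ A₀)
        (by
          rw [Finset.sdiff_nonempty]
          intro h
          have := Finset.card_le_card h
          omega) := by
  generalize_proofs hF hSA
  have hp : ∀ B ∈ (Finset.powersetCard k S).filter (fun B => A₀ ⊆ B), ∀ j,
      p₂ B j = if j ∈ S \ B then ((S.card - k : ℕ) : ENNReal)⁻¹ else 0 := by
    intro B hB j
    have hB' := hB
    simp only [Finset.mem_filter, Finset.mem_powersetCard] at hB'
    obtain ⟨⟨hBS, hc⟩, hAB⟩ := hB'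
    have hcd : (S \ B).card = S.card - k := by rw [Finset.card_sdiff_of_subset hBS, hc]
    have hne : (S \ B).Nonempty := by rw [← Finset.card_pos]; omega
    rw [hp₂ B hB hne, PMF.uniformOfFinset_apply, hcd]
    congr
  ext j
  rw [PMF.bind_apply, tsum_eq_sum (s := (Finset.powersetCard k S).filter (fun B => A₀ ⊆ B))
    (fun B hB => by rw [PMF.uniformOfFinset_apply_of_notMem _ hB, zero_mul])]
  by_cases hj : j ∈ S \ A₀
  · have hcount := aux_count S A₀ k j hj
    rw [PMF.uniformOfFinset_apply_of_mem _ hj]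
    have hjS := (Finset.mem_sdiff.1 hj).1
    rw [Finset.sum_congr rfl (g := fun B => if j ∉ B then
      ((((Finset.powersetCard k S).filter (fun B => A₀ ⊆ B)).card : ENNReal)⁻¹ *
        ((S.card - k : ℕ) : ENNReal)⁻¹) else 0) (fun B hB => by
        rw [hp B hB, PMF.uniformOfFinset_apply_of_mem _ hB]
        simp [hjS]), ← Finset.sum_filter, Finset.sum_const, nsmul_eq_mul]
    have hF0 := hF.card_pos
    have hS0 := hSA.card_pos
    have hm : 0 < S.card - k := by omega
    generalize (((Finset.powersetCard k S).filter (fun B => A₀ ⊆ B)).filter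
      (fun B => j ∉ B)).card = N at *
    generalize ((Finset.powersetCard k S).filter (fun B => A₀ ⊆ B)).card = f at *
    generalize S.card - k = m at *
    generalize (S \ A₀).card = n at *
    rw [← ENNReal.mul_inv (Or.inr (ENNReal.natCast_ne_top m)) (Or.inl (ENNReal.natCast_ne_top f)),
      ← Nat.cast_mul, ← hcount, Nat.cast_mul,
      ENNReal.mul_inv (Or.inr (ENNReal.natCast_ne_top N)) (Or.inl (ENNReal.natCast_ne_top n)),
      mul_left_comm, ENNReal.mul_inv_cancel _ (ENNReal.natCast_ne_top N), mul_one]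
    rw [Nat.cast_ne_zero]
    rintro rfl
    have := Nat.mul_pos hF0 hm
    omega
  · rw [PMF.uniformOfFinset_apply_of_notMem _ hj]
    apply Finset.sum_eq_zero
    intro B hB
    rw [hp B hB, if_neg, mul_zero]
    intro h
    rw [Finset.mem_sdiff] at h hj
    exact hj ⟨h.1, fun hx => h.2 ((Finset.mem_filter.1 hB).2 hx)⟩
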